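/- arXiv:2003.09502 — 3 statements merged into one kernel-verified Lean document; each statement's English description precedes it below -/
import Mathlib

section
/- Let G be a finite group, ρ a finite-dimensional complex representation of G with character χ_ρ, and N = ker ρ. For irreducible characters χ_i, χ_j of G, the following are equivalent: (1) χ_i and χ_j lie in the same strongly connected component of the McKay quiver, i.e., there exist L, M ≥ 0 with ⟨χ_ρ^L · χ_i, χ_j⟩ ≥ 1 and ⟨χ_ρ^M · χ_j, χ_i⟩ ≥ 1; (2) χ_i and χ_j lie in the same weakly connected component, i.e., they are related by the reflexive-symmetric-transitive closure of the relation 'there is an edge', where there is an edge from χ to χ' iff ⟨χ_ρ · χ, χ'⟩ ≥ 1; (3) the restrictions of χ_i and χ_j to N are proportional: there exists c ∈ ℂ with χ_i(n) = c · χ_j(n) for all n ∈ N. -/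
open scoped ComplexOrder

/-- A function `χ : G → ℂ` is an irreducible character of `G` if it is the character of
some simple (irreducible) finite-dimensional complex representation of `G`. -/
def IsIrrChar (G : Type) [Group G] (χ : G → ℂ) : Prop :=
  ∃ V : FDRep ℂ G, CategoryTheory.Simple V ∧ V.character = χ

/-- The standard inner product of complex-valued class functions on a finite group. -/
noncomputable def innChar (G : Type) [Group G] [Fintype G] (φ ψ : G → ℂ) : ℂ :=
  (Fintype.card G : ℂ)⁻¹ * ∑ g : G, φ g * (starRingEnd ℂ) (ψ g)

/-- A representation of a finite group by matrices can be made unitary by a change of basis. -/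
theorem exists_isUnit_conjTranspose_mul_invariant {G n : Type*} [Group G] [Fintype G] [Fintype n]
    [DecidableEq n] (A : G →* Matrix n n ℂ) :
    ∃ S : Matrix n n ℂ, IsUnit S ∧
      ∀ g, (A g).conjTranspose * (S.conjTranspose * S) * A g = S.conjTranspose * S := by
  classical
  have hpos : (∑ g : G, (A g).conjTranspose * A g).PosDef := by
    rw [← Finset.add_sum_erase _ _ (Finset.mem_univ (1 : G))]
    refine Matrix.PosDef.add_posSemidef ?_ (Matrix.posSemidef_sum _ fun g _ ↦
      Matrix.posSemidef_conjTranspose_mul_self _)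
    simpa using Matrix.PosDef.one
  obtain ⟨S, hS⟩ : ∃ S : Matrix n n ℂ, ∑ g : G, (A g).conjTranspose * A g = S.conjTranspose * S := by
    open scoped MatrixOrder Matrix.Norms.L2Operator in
    exact CStarAlgebra.nonneg_iff_eq_star_mul_self.mp hpos.posSemidef.nonneg
  refine ⟨S, ?_, fun h ↦ ?_⟩
  · have := hpos.isUnit
    rw [hS] at this
    rw [Matrix.isUnit_iff_isUnit_det, Matrix.det_mul] at this
    exact (Matrix.isUnit_iff_isUnit_det _).mpr (isUnit_of_mul_isUnit_right this)
  · rw [← hS, Finset.mul_sum, Finset.sum_mul]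
    refine Fintype.sum_equiv (Equiv.mulRight h) _ _ fun g ↦ ?_
    simp [Matrix.conjTranspose_mul, mul_assoc]

/-- A representation of a finite group by matrices is conjugate to a unitary one. -/
theorem exists_unitary_conj {G n : Type*} [Group G] [Fintype G] [Fintype n]
    [DecidableEq n] (A : G →* Matrix n n ℂ) :
    ∃ S T : Matrix n n ℂ, S * T = 1 ∧ T * S = 1 ∧
      ∀ g, (S * A g * T).conjTranspose * (S * A g * T) = 1 := by
  obtain ⟨S, hS, h⟩ := exists_isUnit_conjTranspose_mul_invariant A
  obtain ⟨u, rfl⟩ := hS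
  refine ⟨u, (u⁻¹ : (Matrix n n ℂ)ˣ), by simp, by simp, fun g ↦ ?_⟩
  have h1 : (u : Matrix n n ℂ) * ((u⁻¹ : (Matrix n n ℂ)ˣ) : Matrix n n ℂ) = 1 := by simp
  have h2 : ((u⁻¹ : (Matrix n n ℂ)ˣ) : Matrix n n ℂ).conjTranspose *
      (u : Matrix n n ℂ).conjTranspose = 1 := by
    rw [← Matrix.conjTranspose_mul, h1, Matrix.conjTranspose_one]
  calc _ = ((u⁻¹ : (Matrix n n ℂ)ˣ) : Matrix n n ℂ).conjTranspose *
        ((A g).conjTranspose * ((u : Matrix n n ℂ).conjTranspose * u) * A g) *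
        ((u⁻¹ : (Matrix n n ℂ)ˣ) : Matrix n n ℂ) := by
        simp only [Matrix.conjTranspose_mul, mul_assoc]
    _ = _ := by rw [h g, ← mul_assoc, h2, one_mul, h1]

namespace FDRep

open CategoryTheory Module

variable {G : Type} [Group G] [Fintype G]

/-- A finite-dimensional complex representation of a finite group is unitary in some basis. -/
theorem exists_unitary_matrix (V : FDRep ℂ G) :
    ∃ U : G →* Matrix (Fin (finrank ℂ V)) (Fin (finrank ℂ V)) ℂ,
      (∀ g, (U g).conjTranspose * U g = 1) ∧ (∀ g, (U g).trace = V.character g) ∧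
      ∀ g, U g = 1 → V.ρ g = 1 := by
  let b := finBasis ℂ V
  let A : G →* Matrix (Fin (finrank ℂ V)) (Fin (finrank ℂ V)) ℂ :=
    (LinearMap.toMatrixAlgEquiv b : _ →* Matrix (Fin (finrank ℂ V)) (Fin (finrank ℂ V)) ℂ).comp V.ρ
  have hA : ∀ g, A g = LinearMap.toMatrixAlgEquiv b (V.ρ g) := fun g ↦ rfl
  obtain ⟨S, T, hST, hTS, h⟩ := exists_unitary_conj A
  refine ⟨⟨⟨fun g ↦ S * A g * T, by simp [hST]⟩, fun x y ↦ ?_⟩, h, fun g ↦ ?_, fun g hg ↦ ?_⟩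
  · simp only [map_mul, mul_assoc]
    rw [← mul_assoc T S, hTS, one_mul]
  · change (S * A g * T).trace = _
    rw [Matrix.trace_mul_cycle, hTS, one_mul, character, LinearMap.trace_eq_matrix_trace ℂ b]
    rfl
  · have hg : S * A g * T = 1 := hg
    have : A g = 1 := by
      calc A g = T * S * A g * (T * S) := by simp [hTS]
        _ = T * (S * A g * T) * S := by simp only [mul_assoc]
        _ = 1 := by rw [hg, mul_one, hTS]
    rw [hA] at this
    exact (LinearMap.toMatrixAlgEquiv b).injective (this.trans (map_one _).symm)

theorem char_inv_eq_conj (V : FDRep ℂ G) (g : G) :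
    V.character g⁻¹ = starRingEnd ℂ (V.character g) := by
  obtain ⟨U, hU, htr, -⟩ := V.exists_unitary_matrix
  have hinv : U g⁻¹ = (U g).conjTranspose := by
    calc U g⁻¹ = (U g).conjTranspose * U g * U g⁻¹ := by rw [hU, one_mul]
      _ = _ := by rw [mul_assoc, ← map_mul]; simp
  rw [← htr, ← htr, hinv, Matrix.trace_conjTranspose]
  rfl

/-- The kernel of a representation is detected by its character. -/
theorem char_eq_char_one_iff (V : FDRep ℂ G) (g : G) :
    V.character g = V.character 1 ↔ V.ρ g = 1 := by
  refine ⟨fun h ↦ ?_, fun h ↦ by simp only [character, h, map_one]⟩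
  obtain ⟨U, hU, htr, hker⟩ := V.exists_unitary_matrix
  refine hker g (sub_eq_zero.mp (Matrix.trace_conjTranspose_mul_self_eq_zero_iff.mp ?_))
  rw [Matrix.conjTranspose_sub, sub_mul, mul_sub, mul_sub, hU]
  simp [Matrix.trace_sub, Matrix.trace_conjTranspose, htr, h]

theorem innChar_eq_finrank (V W : FDRep ℂ G) :
    innChar G V.character W.character = finrank ℂ (W ⟶ V) := by
  have := invertibleOfNonzero (NeZero.ne (Nat.card G : ℂ))
  rw [← scalar_product_char_eq_finrank_equivariant, innChar]
  simp [char_inv_eq_conj]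

theorem one_le_innChar_iff (V W : FDRep ℂ G) :
    1 ≤ innChar G V.character W.character ↔ innChar G V.character W.character ≠ 0 := by
  rw [innChar_eq_finrank]
  norm_cast
  exact Nat.one_le_iff_ne_zero

omit [Fintype G] in
theorem exists_character_eq_pow (V : FDRep ℂ G) (L : ℕ) :
    ∃ P : FDRep ℂ G, P.character = V.character ^ L := by
  induction L with
  | zero =>
    refine ⟨FDRep.of (Representation.trivial ℂ G ℂ), ?_⟩
    ext g
    simp [character]
  | succ L ih =>
    obtain ⟨P, hP⟩ := ih
    exact ⟨MonoidalCategory.tensorObj P V, by rw [char_tensor, hP, pow_succ]⟩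

theorem char_one_ne_zero (V : FDRep ℂ G) [Simple V] : V.character 1 ≠ 0 := by
  intro h
  rw [char_one, Nat.cast_eq_zero] at h
  have := finrank_zero_iff.mp h
  have hs := (simple_iff_char_is_norm_one V).mp inferInstance
  have h0 : ∀ g, V.character g = 0 := fun g ↦ by
    rw [character, Subsingleton.elim (V.ρ g) 0, map_zero]
  simp only [h0, mul_zero, Finset.sum_const_zero] at hs
  exact NeZero.ne (Nat.card G : ℂ) hs.symm

omit [Fintype G] in
/-- Schur's lemma for an endomorphism of a simple representation. -/
theorem exists_eq_smul_one_of_commute (V : FDRep ℂ G) [Simple V] (T : V →ₗ[ℂ] V)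
    (hT : ∀ g, T ∘ₗ V.ρ g = V.ρ g ∘ₗ T) : ∃ c : ℂ, T = c • 1 := by
  let e := Representation.linHom.invariantsEquivRepHom
    ((forget₂ (FDRep ℂ G) (Rep ℂ G)).obj V) ((forget₂ (FDRep ℂ G) (Rep ℂ G)).obj V) ≪≫ₗ
    FDRep.forget₂HomLinearEquiv V V
  let T' : (Representation.linHom V.ρ V.ρ).invariants := ⟨T, fun g ↦
    (Representation.linHom.mem_invariants_iff_comm
      (X := (forget₂ (FDRep ℂ G) (Rep ℂ G)).obj V)
      (Y := (forget₂ (FDRep ℂ G) (Rep ℂ G)).obj V) T g).2 (hT g)⟩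
  obtain ⟨c, hc⟩ := endomorphism_simple_eq_smul_id ℂ (e T')
  refine ⟨c, ?_⟩
  have h1 : e.symm (c • 𝟙 V) = T' := by rw [hc]; exact e.symm_apply_apply T'
  exact (congrArg Subtype.val h1).symm

/-- The sum over a conjugacy class acts on a simple representation as a scalar. -/
theorem char_one_mul_sum_char_conj_mul (V : FDRep ℂ G) [Simple V] (n h : G) :
    V.character 1 * ∑ g : G, V.character (g * n * g⁻¹ * h) =
      Fintype.card G * V.character n * V.character h := by
  obtain ⟨c, hc⟩ := V.exists_eq_smul_one_of_commute (∑ g : G, V.ρ (g * n * g⁻¹)) fun x ↦ by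
    change _ * V.ρ x = V.ρ x * _
    rw [Finset.sum_mul, Finset.mul_sum]
    refine Fintype.sum_equiv (Equiv.mulLeft x⁻¹) _ _ fun g ↦ ?_
    rw [← map_mul, ← map_mul]
    congr 1
    simp [mul_assoc]
  have h1 : ∑ g : G, V.character (g * n * g⁻¹ * h) = c * V.character h := by
    calc _ = LinearMap.trace ℂ V ((∑ g : G, V.ρ (g * n * g⁻¹)) * V.ρ h) := by
          simp only [character, Finset.sum_mul, map_sum, map_mul]
      _ = _ := by rw [hc, smul_mul_assoc, one_mul, map_smul]; rfl
  have h2 : Fintype.card G * V.character n = c * V.character 1 := by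
    calc _ = LinearMap.trace ℂ V (∑ g : G, V.ρ (g * n * g⁻¹)) := by
          rw [map_sum]
          change _ = ∑ g : G, V.character (g * n * g⁻¹)
          simp
      _ = _ := by rw [hc, map_smul]; simp [character]
  rw [h1, h2]
  ring

/-- If `W` is a constituent of `P ⊗ V` and `n` acts trivially on `P`, then the normalized
characters of `V` and `W` agree at `n`. -/
theorem char_mul_char_one_eq (V W : FDRep ℂ G) [Simple V] [Simple W] (P : G → ℂ)
    (hP : innChar G (P * V.character) W.character ≠ 0) (n : G)
    (hn : ∀ g h, P (g * n * g⁻¹ * h) = P h) :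
    V.character n * W.character 1 = V.character 1 * W.character n := by
  simp only [innChar, ← char_inv_eq_conj, Pi.mul_apply] at hP
  have hS := right_ne_zero_of_mul hP
  set S := ∑ g : G, P g * V.character g * W.character g⁻¹ with hSdef
  have h1 : V.character 1 * ∑ g : G, ∑ h : G,
      P h * V.character (g * n * g⁻¹ * h) * W.character h⁻¹ =
      Fintype.card G * V.character n * S := by
    rw [Finset.sum_comm, hSdef, Finset.mul_sum, Finset.mul_sum]
    refine Finset.sum_congr rfl fun h _ ↦ ?_
    rw [← Finset.sum_mul, ← Finset.mul_sum]
    linear_combination P h * W.character h⁻¹ * V.char_one_mul_sum_char_conj_mul n h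
  have h2 : W.character 1 * ∑ g : G, ∑ h : G,
      P h * V.character (g * n * g⁻¹ * h) * W.character h⁻¹ =
      Fintype.card G * W.character n * S := by
    have : ∀ g : G, ∑ h : G, P h * V.character (g * n * g⁻¹ * h) * W.character h⁻¹ =
        ∑ h : G, P h * V.character h * W.character (g * n * g⁻¹ * h⁻¹) := fun g ↦ by
      refine Fintype.sum_equiv (Equiv.mulLeft (g * n * g⁻¹)) _ _ fun h ↦ ?_
      rw [Equiv.coe_mulLeft, hn, mul_inv_rev, ← mul_assoc _ h⁻¹, W.char_mul_comm,
        inv_mul_cancel_left]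
    simp only [this]
    rw [Finset.sum_comm, hSdef, Finset.mul_sum, Finset.mul_sum]
    refine Finset.sum_congr rfl fun h _ ↦ ?_
    rw [← Finset.mul_sum]
    linear_combination P h * V.character h * W.char_one_mul_sum_char_conj_mul n h⁻¹
  have hcard : (Fintype.card G : ℂ) ≠ 0 := by simp
  refine mul_left_cancel₀ (mul_ne_zero hcard hS) ?_
  linear_combination V.character 1 * h2 - W.character 1 * h1

end FDRep

open Module in
/-- Complete reducibility for characters. -/
theorem Representation.character_mem_closure_isIrrChar {G : Type} [Group G] [Fintype G] {V : Type}
    [AddCommGroup V] [Module ℂ V] [FiniteDimensional ℂ V] (ρ : Representation ℂ G V) :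
    ρ.character ∈ AddSubmonoid.closure {χ | IsIrrChar G χ} := by
  have := invertibleOfNonzero (NeZero.ne (Nat.card G : ℂ))
  by_cases hirr : ρ.IsIrreducible
  · refine AddSubmonoid.subset_closure ⟨FDRep.of ρ, ?_, rfl⟩
    rw [FDRep.simple_iff_char_is_norm_one]
    have h := ρ.char_orthonormal ρ
    rw [if_pos ⟨.refl ρ⟩, inv_mul_eq_one₀ (NeZero.ne _)] at h
    exact h.symm
  rcases subsingleton_or_nontrivial V with hV | hV
  · have : ρ.character = 0 := by
      ext g
      rw [character, Subsingleton.elim (ρ g) 0, map_zero, Pi.zero_apply]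
    exact this ▸ zero_mem _
  have : Nontrivial (Subrepresentation ρ) := ⟨⊥, ⊤, fun h ↦
    bot_ne_top (α := Submodule ℂ V) (congrArg Subrepresentation.toSubmodule h)⟩
  obtain ⟨σ, hbot, htop⟩ : ∃ σ : Subrepresentation ρ, σ ≠ ⊥ ∧ σ ≠ ⊤ := by
    by_contra! h
    exact hirr ⟨fun σ ↦ or_iff_not_imp_left.mpr (h σ)⟩
  obtain ⟨τ, hc⟩ := exists_isCompl σ
  have hcompl : IsCompl σ.toSubmodule τ.toSubmodule :=
    ⟨disjoint_iff.mpr (congrArg Subrepresentation.toSubmodule hc.inf_eq_bot),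
      codisjoint_iff.mpr (congrArg Subrepresentation.toSubmodule hc.sup_eq_top)⟩
  have hsum : ρ.character = σ.toRepresentation.character + τ.toRepresentation.character := by
    ext g
    have hint := (DirectSum.isInternal_submodule_iff_isCompl
      (fun b : Bool ↦ cond b σ.toSubmodule τ.toSubmodule) (i := true) (j := false) (by simp)
      (by ext b; cases b <;> simp)).mpr hcompl
    have := LinearMap.trace_eq_sum_trace_restrict hint (f := ρ g) (by
      rintro (_ | _)
      exacts [τ.apply_mem_toSubmodule g, σ.apply_mem_toSubmodule g])
    rw [Fintype.sum_bool] at this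
    exact this
  have hdim := Submodule.finrank_add_eq_of_isCompl hcompl
  have hσ : 0 < finrank ℂ σ.toSubmodule := by
    rw [Nat.pos_iff_ne_zero, Ne, Submodule.finrank_eq_zero]
    exact fun h ↦ hbot (Subrepresentation.toSubmodule_injective h)
  have hτ : 0 < finrank ℂ τ.toSubmodule := by
    rw [Nat.pos_iff_ne_zero, Ne, Submodule.finrank_eq_zero]
    intro h
    rw [h] at hcompl
    exact htop (Subrepresentation.toSubmodule_injective (eq_top_of_isCompl_bot hcompl))
  rw [hsum]
  exact add_mem σ.toRepresentation.character_mem_closure_isIrrChar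
    τ.toRepresentation.character_mem_closure_isIrrChar
termination_by finrank ℂ V
decreasing_by all_goals omega

theorem FDRep.character_mem_closure_isIrrChar {G : Type} [Group G] [Fintype G] (V : FDRep ℂ G) :
    V.character ∈ AddSubmonoid.closure {χ | IsIrrChar G χ} :=
  Representation.character_mem_closure_isIrrChar (V := V) V.ρ

/-- If all weighted power sums of `f` vanish, so do the sums of the weights over the fibres. -/
theorem sum_filter_eq_zero_of_forall_sum_pow_mul_eq_zero {ι K : Type*} [Fintype ι] [Field K]
    [DecidableEq K] (f θ : ι → K) (h : ∀ L : ℕ, ∑ x, f x ^ L * θ x = 0) (d : K) :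
    ∑ x with f x = d, θ x = 0 := by
  open Polynomial in
  have hp : ∀ p : K[X], ∑ x, p.eval (f x) * θ x = 0 := fun p ↦ by
    simp only [eval_eq_sum_range, Finset.sum_mul]
    rw [Finset.sum_comm]
    refine Finset.sum_eq_zero fun L _ ↦ ?_
    simp only [mul_assoc]
    rw [← Finset.mul_sum, h, mul_zero]
  let p : Polynomial K := ∏ v ∈ (Finset.univ.image f).erase d, (.X - .C v)
  have hd : p.eval d ≠ 0 := by
    simp only [p, Polynomial.eval_prod, Finset.prod_ne_zero_iff]
    intro v hv
    simpa [sub_eq_zero] using (Finset.ne_of_mem_erase hv).symm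
  have hz : ∀ x, f x ≠ d → p.eval (f x) = 0 := fun x hx ↦ by
    simp only [p, Polynomial.eval_prod]
    exact Finset.prod_eq_zero (i := f x) (by simp [hx]) (by simp)
  refine (mul_eq_zero.mp ?_).resolve_left hd
  rw [← hp p, Finset.sum_filter, Finset.mul_sum]
  refine Finset.sum_congr rfl fun x _ ↦ ?_
  split_ifs with hx
  · rw [hx]
  · simp [hz x hx]

namespace FDRep

open CategoryTheory

variable {G : Type} [Group G] [Fintype G]

/-- If the restrictions of two simple representations to the kernel of `ρ` have proportional
characters, then one is a constituent of some tensor power of `ρ` times the other. -/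
theorem exists_innChar_pow_ne_zero (ρ V W : FDRep ℂ G) [Simple V] [Simple W] (c : ℂ)
    (h : ∀ n, ρ.ρ n = 1 → V.character n = c * W.character n) :
    ∃ L : ℕ, innChar G (ρ.character ^ L * V.character) W.character ≠ 0 := by
  classical
  by_contra! h0
  have hcard : (Fintype.card G : ℂ)⁻¹ ≠ 0 := by simp
  have hpow : ∀ L : ℕ, ∑ g, ρ.character g ^ L *
      (V.character g * starRingEnd ℂ (W.character g)) = 0 := fun L ↦ by
    refine (mul_eq_zero.mp (Eq.trans ?_ (h0 L))).resolve_left hcard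
    simp [innChar, mul_assoc]
  have hsum := sum_filter_eq_zero_of_forall_sum_pow_mul_eq_zero _ _ hpow (ρ.character 1)
  simp only [char_eq_char_one_iff] at hsum
  have hsum' : c * ∑ n with ρ.ρ n = 1, (Complex.normSq (W.character n) : ℂ) = 0 := by
    rw [← hsum, Finset.mul_sum]
    refine Finset.sum_congr rfl fun n hn ↦ ?_
    rw [h n (Finset.mem_filter.mp hn).2, mul_assoc, Complex.mul_conj]
  have hc : c ≠ 0 := by
    rintro rfl
    exact V.char_one_ne_zero (by simpa using h 1 (map_one _))
  have hz := (mul_eq_zero.mp hsum').resolve_left hc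
  rw [← Complex.ofReal_sum, Complex.ofReal_eq_zero,
    Finset.sum_eq_zero_iff_of_nonneg fun n _ ↦ Complex.normSq_nonneg _] at hz
  exact W.char_one_ne_zero (Complex.normSq_eq_zero.mp (hz 1 (by simp)))

omit [Fintype G] in
theorem character_conj_mul_of_apply_eq_one (ρ : FDRep ℂ G) {n : G} (hn : ρ.ρ n = 1) (g h : G) :
    ρ.character (g * n * g⁻¹ * h) = ρ.character h := by
  have : ρ.ρ (g * n * g⁻¹) = 1 := by
    rw [map_mul, map_mul, hn, mul_one, ← map_mul, mul_inv_cancel, map_one]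
  simp [character, map_mul ρ.ρ (g * n * g⁻¹) h, this]

end FDRep

theorem innChar_add_left (G : Type) [Group G] [Fintype G] (φ ψ χ : G → ℂ) :
    innChar G (φ + ψ) χ = innChar G φ χ + innChar G ψ χ := by
  simp only [innChar, Pi.add_apply, add_mul, Finset.sum_add_distrib, mul_add]

namespace IsIrrChar

variable {G : Type} [Group G] [Fintype G] {χ ψ : G → ℂ}

theorem innChar_self_ne_zero (hχ : IsIrrChar G χ) : innChar G χ χ ≠ 0 := by
  obtain ⟨V, hV, rfl⟩ := hχ
  rw [FDRep.innChar_eq_finrank, CategoryTheory.finrank_endomorphism_simple_eq_one]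
  simp

theorem apply_one_ne_zero (hχ : IsIrrChar G χ) : χ 1 ≠ 0 := by
  obtain ⟨V, hV, rfl⟩ := hχ
  exact V.char_one_ne_zero

theorem one_le_innChar_pow_mul_iff (ρ : FDRep ℂ G) (L : ℕ) (hχ : IsIrrChar G χ)
    (hψ : IsIrrChar G ψ) :
    1 ≤ innChar G (ρ.character ^ L * χ) ψ ↔ innChar G (ρ.character ^ L * χ) ψ ≠ 0 := by
  obtain ⟨V, -, rfl⟩ := hχ
  obtain ⟨W, -, rfl⟩ := hψ
  obtain ⟨P, hP⟩ := ρ.exists_character_eq_pow L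
  rw [← hP, ← FDRep.char_tensor]
  exact FDRep.one_le_innChar_iff _ W

/-- Irreducible characters joined by a walk have proportional restrictions to the kernel. -/
theorem mul_apply_one_eq_of_innChar_pow_ne_zero (ρ : FDRep ℂ G) (L : ℕ) (hχ : IsIrrChar G χ)
    (hψ : IsIrrChar G ψ) (h : innChar G (ρ.character ^ L * χ) ψ ≠ 0) {n : G} (hn : ρ.ρ n = 1) :
    χ n * ψ 1 = χ 1 * ψ n := by
  obtain ⟨V, hV, rfl⟩ := hχ
  obtain ⟨W, hW, rfl⟩ := hψ
  refine V.char_mul_char_one_eq W _ h n fun g h ↦ ?_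
  rw [Pi.pow_apply, Pi.pow_apply, ρ.character_conj_mul_of_apply_eq_one hn]

end IsIrrChar

/-- If `φ` is a sum of irreducible characters and `χ` occurs in `X * φ`, then `χ` occurs in `X * ψ`
for some irreducible constituent `ψ` of `φ`. -/
theorem exists_isIrrChar_of_innChar_mul_ne_zero {G : Type} [Group G] [Fintype G] (X χ : G → ℂ)
    {φ : G → ℂ} (hφ : φ ∈ AddSubmonoid.closure {χ | IsIrrChar G χ})
    (h : innChar G (X * φ) χ ≠ 0) :
    ∃ ψ, IsIrrChar G ψ ∧ innChar G φ ψ ≠ 0 ∧ innChar G (X * ψ) χ ≠ 0 := by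
  have hnonneg : ∀ φ ∈ AddSubmonoid.closure {χ | IsIrrChar G χ}, ∀ ψ, IsIrrChar G ψ →
      0 ≤ innChar G φ ψ := by
    intro φ hφ ψ hψ
    induction hφ using AddSubmonoid.closure_induction with
    | mem φ hφ =>
      obtain ⟨V, -, rfl⟩ := hφ
      obtain ⟨W, -, rfl⟩ := hψ
      rw [FDRep.innChar_eq_finrank]
      exact Nat.cast_nonneg _
    | zero => simp [innChar]
    | add φ φ' _ _ h h' => exact innChar_add_left G φ φ' ψ ▸ add_nonneg h h'
  induction hφ using AddSubmonoid.closure_induction with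
  | mem φ hφ => exact ⟨φ, hφ, hφ.innChar_self_ne_zero, h⟩
  | zero => simp [innChar] at h
  | add φ φ' hφ hφ' ih ih' =>
    have hor : innChar G (X * φ) χ ≠ 0 ∨ innChar G (X * φ') χ ≠ 0 := by
      by_contra! h0
      exact h (by rw [mul_add, innChar_add_left, h0.1, h0.2, add_zero])
    rcases hor with h1 | h1
    · obtain ⟨ψ, hψ, hne, hX⟩ := ih h1
      refine ⟨ψ, hψ, ?_, hX⟩
      rw [innChar_add_left]
      exact fun h0 ↦ hne ((add_eq_zero_iff_of_nonneg (hnonneg φ hφ ψ hψ)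
        (hnonneg φ' hφ' ψ hψ)).mp h0).1
    · obtain ⟨ψ, hψ, hne, hX⟩ := ih' h1
      refine ⟨ψ, hψ, ?_, hX⟩
      rw [innChar_add_left]
      exact fun h0 ↦ hne ((add_eq_zero_iff_of_nonneg (hnonneg φ hφ ψ hψ)
        (hnonneg φ' hφ' ψ hψ)).mp h0).2

/-- A constituent of a power of `χ` times an irreducible character is reached by a walk in the
McKay quiver. -/
theorem reflTransGen_of_innChar_pow_ne_zero {G : Type} [Group G] [Fintype G]
    (Irr : Finset (G → ℂ)) (hIrr : ∀ χ, χ ∈ Irr ↔ IsIrrChar G χ) (ρ : FDRep ℂ G) (L : ℕ)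
    (i j : Irr) (h : innChar G (ρ.character ^ L * i) j ≠ 0) :
    Relation.ReflTransGen (fun a b : Irr ↦ 1 ≤ innChar G (ρ.character * a) b) i j := by
  have hirr (a : Irr) : IsIrrChar G a := (hIrr a).mp a.2
  induction L generalizing i with
  | zero =>
    have hij : i = j := by
      obtain ⟨V, hV, hVi⟩ := hirr i
      obtain ⟨W, hW, hWj⟩ := hirr j
      rw [pow_zero, one_mul, ← hVi, ← hWj, FDRep.innChar_eq_finrank,
        FDRep.finrank_hom_simple_simple] at h
      have hiso : Nonempty (W ≅ V) := by
        by_contra hne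
        simp [hne] at h
      exact Subtype.ext (by rw [← hVi, ← hWj, FDRep.char_iso hiso.some])
    exact hij ▸ .refl
  | succ L ih =>
    have hmem : ρ.character * (i : G → ℂ) ∈ AddSubmonoid.closure {χ | IsIrrChar G χ} := by
      obtain ⟨V, -, hV⟩ := hirr i
      rw [← hV, ← FDRep.char_tensor]
      exact FDRep.character_mem_closure_isIrrChar _
    rw [pow_succ, mul_assoc] at h
    obtain ⟨ψ, hψ, h1, h2⟩ :=
      exists_isIrrChar_of_innChar_mul_ne_zero (ρ.character ^ L) (j : G → ℂ) hmem h
    refine .head (b := ⟨ψ, (hIrr ψ).mpr hψ⟩) ?_ (ih ⟨ψ, (hIrr ψ).mpr hψ⟩ h2)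
    have hedge := (hirr i).one_le_innChar_pow_mul_iff ρ 1 hψ
    rw [pow_one] at hedge
    exact hedge.mpr h1

/-- For irreducible characters `χᵢ, χⱼ` of `G` the following are equivalent:
(1) they lie in the same strongly connected component of the McKay quiver of `ρ`
    (there are walks in both directions);
(2) they lie in the same weakly connected component (they are related by the
    reflexive-symmetric-transitive closure of the edge relation);
(3) their restrictions to `N = ker ρ` are proportional. -/
theorem mckay_connected_components (G : Type) [Group G] [Fintype G]
    (Irr : Finset (G → ℂ)) (hIrr : ∀ χ, χ ∈ Irr ↔ IsIrrChar G χ)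
    (ρ : FDRep ℂ G) (i j : ↑Irr) :
    (((∃ L : ℕ, 1 ≤ innChar G (ρ.character ^ L * ↑i) ↑j) ∧
        (∃ M : ℕ, 1 ≤ innChar G (ρ.character ^ M * ↑j) ↑i)) ↔
      (∃ c : ℂ, ∀ n : G, ρ.ρ n = 1 → (↑i : G → ℂ) n = c * (↑j : G → ℂ) n)) ∧
    ((Relation.EqvGen (fun a b : ↑Irr => 1 ≤ innChar G (ρ.character * ↑a) ↑b) i j) ↔
      (∃ c : ℂ, ∀ n : G, ρ.ρ n = 1 → (↑i : G → ℂ) n = c * (↑j : G → ℂ) n)) := by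
  have hirr (a : Irr) : IsIrrChar G a := (hIrr a).mp a.2
  have hwalk (a b : Irr) (c : ℂ) (h : ∀ n, ρ.ρ n = 1 → (a : G → ℂ) n = c * (b : G → ℂ) n) :
      ∃ L : ℕ, innChar G (ρ.character ^ L * a) b ≠ 0 := by
    obtain ⟨V, hV, hVa⟩ := hirr a
    obtain ⟨W, hW, hWb⟩ := hirr b
    rw [← hVa, ← hWb] at h ⊢
    exact ρ.exists_innChar_pow_ne_zero V W c h
  have hprop (a b : Irr) (h : ∀ n, ρ.ρ n = 1 →
      (a : G → ℂ) n * (b : G → ℂ) 1 = (a : G → ℂ) 1 * (b : G → ℂ) n) :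
      ∃ c : ℂ, ∀ n, ρ.ρ n = 1 → (a : G → ℂ) n = c * (b : G → ℂ) n := by
    refine ⟨(a : G → ℂ) 1 / (b : G → ℂ) 1, fun n hn ↦ ?_⟩
    have := (hirr b).apply_one_ne_zero
    field_simp
    exact h n hn
  refine ⟨⟨fun ⟨⟨L, hL⟩, _⟩ ↦ hprop i j fun n hn ↦ ?_, fun ⟨c, hc⟩ ↦ ?_⟩,
    fun h ↦ hprop i j ?_, fun ⟨c, hc⟩ ↦ ?_⟩
  · exact (hirr i).mul_apply_one_eq_of_innChar_pow_ne_zero ρ L (hirr j)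
      (((hirr i).one_le_innChar_pow_mul_iff ρ L (hirr j)).mp hL) hn
  · have hc0 : c ≠ 0 := by
      rintro rfl
      exact (hirr i).apply_one_ne_zero (by simpa using hc 1 (map_one _))
    obtain ⟨L, hL⟩ := hwalk i j c hc
    obtain ⟨M, hM⟩ := hwalk j i c⁻¹ fun n hn ↦ by rw [hc n hn, inv_mul_cancel_left₀ hc0]
    exact ⟨⟨L, ((hirr i).one_le_innChar_pow_mul_iff ρ L (hirr j)).mpr hL⟩,
      M, ((hirr j).one_le_innChar_pow_mul_iff ρ M (hirr i)).mpr hM⟩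
  · intro n hn
    induction h with
    | rel a b hab =>
      rw [← pow_one ρ.character] at hab
      exact (hirr a).mul_apply_one_eq_of_innChar_pow_ne_zero ρ 1 (hirr b)
        (((hirr a).one_le_innChar_pow_mul_iff ρ 1 (hirr b)).mp hab) hn
    | refl a => exact mul_comm _ _
    | symm a b _ ih => linear_combination -ih
    | trans a b d _ _ ih ih' =>
      refine mul_left_cancel₀ (hirr b).apply_one_ne_zero ?_
      linear_combination (d : G → ℂ) 1 * ih + (a : G → ℂ) 1 * ih'
  · obtain ⟨L, hL⟩ := hwalk i j c hc
    exact Relation.EqvGen.reflTransGen_le_eqvGen _ _ _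
      (reflTransGen_of_innChar_pow_ne_zero Irr hIrr ρ L i j hL)
end

section
/- Let G be a finite group and ρ a finite-dimensional complex representation of G. The dimension of the complex eigenspace of the McKay matrix A_ρ(G) for the eigenvalue dim ρ, i.e., the dimension of {v : Irr(G) → ℂ | A_ρ(G)·v = (dim ρ)·v}, equals the number of conjugacy classes of G contained in ker ρ. -/
open Module

theorem Module.End.exists_eigenbasis_of_pow_eq_one {V : Type*} [AddCommGroup V] [Module ℂ V]
    [FiniteDimensional ℂ V] (T : Module.End ℂ V) {n : ℕ} (hn : n ≠ 0) (hT : T ^ n = 1) :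
    ∃ (ι : Type) (_ : Fintype ι) (b : Basis ι ℂ V) (μ : ι → ℂ),
      (∀ i, T (b i) = μ i • b i) ∧ ∀ i, ‖μ i‖ = 1 := by
  classical
  have hss : T.IsSemisimple := by
    refine Module.End.isSemisimple_of_squarefree_aeval_eq_zero
      (p := (Polynomial.X ^ n - 1 : Polynomial ℂ)) ?_ (by simp [hT])
    exact (Polynomial.X_pow_sub_one_separable_iff.mpr (by exact_mod_cast hn)).squarefree
  have hint := DirectSum.isInternal_submodule_of_iSupIndep_of_iSup_eq_top
    T.eigenspaces_iSupIndep hss.iSup_eigenspace_eq_top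
  let b := hint.collectedBasis fun μ ↦ finBasis ℂ (T.eigenspace μ)
  have hb (i) : T (b i) = i.1 • b i :=
    Module.End.mem_eigenspace_iff.mp (hint.collectedBasis_mem _ i)
  have hpow (i) (k : ℕ) : (T ^ k) (b i) = i.1 ^ k • b i := by
    induction k with
    | zero => simp
    | succ k ih => rw [pow_succ', Module.End.mul_apply, ih, map_smul, hb, smul_smul, pow_succ]
  refine ⟨_, FiniteDimensional.fintypeBasisIndex b, b, fun i ↦ i.1, hb, fun i ↦ ?_⟩
  refine Complex.norm_eq_one_of_pow_eq_one (n := n) ?_ hn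
  have h := hpow i n
  rw [hT, Module.End.one_apply] at h
  exact (smul_left_injective ℂ (b.ne_zero i) (by simpa using h)).symm

theorem LinearMap.trace_eq_sum_of_eigenbasis {R V ι : Type*} [CommRing R] [AddCommGroup V]
    [Module R V] [Fintype ι] (b : Basis ι R V) (T : Module.End R V) (μ : ι → R)
    (h : ∀ i, T (b i) = μ i • b i) : LinearMap.trace R V T = ∑ i, μ i := by
  classical
  simp [LinearMap.trace_eq_matrix_trace R b, Matrix.trace, LinearMap.toMatrix_apply, h]

namespace Representation

variable {G V : Type*} [Group G] [AddCommGroup V] [Module ℂ V] [FiniteDimensional ℂ V]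

theorem char_inv_eq_conj [Finite G] (σ : Representation ℂ G V) (g : G) :
    σ.character g⁻¹ = (starRingEnd ℂ) (σ.character g) := by
  obtain ⟨ι, _, b, μ, hb, hμ⟩ := Module.End.exists_eigenbasis_of_pow_eq_one (σ g)
    (orderOf_pos g).ne' (by rw [← map_pow, pow_orderOf_eq_one, map_one])
  have hinv (i) : σ g⁻¹ (b i) = (μ i)⁻¹ • b i := by
    have hne : μ i ≠ 0 := norm_ne_zero_iff.mp (by simp [hμ])
    rw [eq_inv_smul_iff₀ hne, ← map_smul, ← hb, inv_self_apply]
  rw [character, character, LinearMap.trace_eq_sum_of_eigenbasis b _ _ hinv,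
    LinearMap.trace_eq_sum_of_eigenbasis b _ _ hb, map_sum]
  exact Finset.sum_congr rfl fun i _ ↦ by
    rw [Complex.inv_def, Complex.normSq_eq_norm_sq, hμ]; simp

theorem char_eq_finrank_iff [Finite G] (σ : Representation ℂ G V) (g : G) :
    σ.character g = finrank ℂ V ↔ σ g = 1 := by
  refine ⟨fun h ↦ ?_, fun h ↦ by rw [character, h, LinearMap.trace_one]⟩
  obtain ⟨ι, _, b, μ, hb, hμ⟩ := Module.End.exists_eigenbasis_of_pow_eq_one (σ g)
    (orderOf_pos g).ne' (by rw [← map_pow, pow_orderOf_eq_one, map_one])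
  rw [character, LinearMap.trace_eq_sum_of_eigenbasis b _ _ hb, finrank_eq_card_basis b] at h
  have hre (i) : (μ i).re ≤ 1 := (Complex.re_le_norm _).trans (hμ i).le
  have hsum : ∑ i, (μ i).re = ∑ _i : ι, (1 : ℝ) := by
    simpa using congrArg Complex.re h
  have hone (i) : μ i = 1 := by
    have h1 := (Finset.sum_eq_sum_iff_of_le fun i _ ↦ hre i).mp hsum i (Finset.mem_univ i)
    have h2 := Complex.sq_norm (μ i)
    rw [hμ, Complex.normSq_apply, h1] at h2
    exact Complex.ext h1 (by simpa using h2)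
  exact b.ext fun i ↦ by simp [hb, hone]

theorem sum_smul_eq_zero_of_sum_mul_char_eq_zero [Fintype G] (σ : Representation ℂ G V)
    [σ.IsIrreducible] {f : G → ℂ} (hf : ∀ g h, f (h * g * h⁻¹) = f g)
    (h : ∑ g, f g * σ.character g = 0) : ∑ g, f g • σ g = 0 := by
  have hcomm (k : G) : (∑ g, f g • σ g) * σ k = σ k * ∑ g, f g • σ g := by
    rw [Finset.sum_mul, Finset.mul_sum]
    refine Fintype.sum_equiv (MulAut.conj k⁻¹).toEquiv _ _ fun g ↦ ?_
    have := hf g k⁻¹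
    simp only [inv_inv] at this
    simp [← map_mul, ← this, mul_assoc]
  let T : IntertwiningMap σ σ :=
    LinearMap.intertwiningMap_of_isIntertwiningMap σ σ (∑ g, f g • σ g)
      fun g v ↦ LinearMap.congr_fun (hcomm g) v
  obtain ⟨c, hc⟩ :=
    (IsIrreducible.algebraMap_intertwiningMap_bijective_of_isAlgClosed (ρ := σ)).2 T
  have hT : ∑ g, f g • σ g = c • (1 : Module.End ℂ V) := by
    ext v
    exact (congrArg (fun S : IntertwiningMap σ σ ↦ S.toLinearMap v) hc).symm
  have htr := congrArg (LinearMap.trace ℂ V) hT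
  have : Nontrivial V := IsSimpleModule.nontrivial (MonoidAlgebra ℂ G) σ.asModule
  have hd : (finrank ℂ V : ℂ) ≠ 0 := by exact_mod_cast finrank_pos.ne'
  have hc0 : c = 0 := by
    simp only [map_sum, map_smul, smul_eq_mul, LinearMap.trace_one] at htr
    exact (mul_eq_zero.mp (htr.symm.trans h)).resolve_right hd
  rw [hT, hc0, zero_smul]

end Representation

theorem FDRep.simple_of_isIrreducible {G V : Type} [Group G] [Finite G] [AddCommGroup V]
    [Module ℂ V] [FiniteDimensional ℂ V] (σ : Representation ℂ G V) [σ.IsIrreducible] :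
    CategoryTheory.Simple (FDRep.of σ) := by
  rw [FDRep.simple_iff_end_is_rank_one,
    ← (Representation.linHom.invariantsEquivFDRepHom (FDRep.of σ) (FDRep.of σ)).finrank_eq]
  exact (Representation.invariantsEquivIntertwiningMap σ σ).finrank_eq.trans
    (Representation.IsIrreducible.finrank_intertwiningMap_self σ)

section OfModule

variable {G : Type} [Group G] {M : Type} [AddCommGroup M] [Module ℂ M]
  [Module (MonoidAlgebra ℂ G) M] [IsScalarTower ℂ (MonoidAlgebra ℂ G) M]

theorem Representation.asAlgebraHom_ofModule'_apply (a : MonoidAlgebra ℂ G) (x : M) :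
    (ofModule' (k := ℂ) (G := G) M).asAlgebraHom a x = a • x :=
  LinearMap.congr_fun (DFunLike.congr_fun
    ((MonoidAlgebra.lift ℂ (Module.End ℂ M) G).apply_symm_apply (Algebra.lsmul ℂ ℂ M)) a) x

theorem Representation.isIrreducible_ofModule' [IsSimpleModule (MonoidAlgebra ℂ G) M] :
    (ofModule' (k := ℂ) (G := G) M).IsIrreducible := by
  let e : (ofModule' (k := ℂ) (G := G) M).asModule ≃ₗ[MonoidAlgebra ℂ G] M :=
    { (ofModule' (k := ℂ) (G := G) M).asModuleEquiv with
      map_smul' := fun a x ↦ (asModuleEquiv_map_smul _ a x).trans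
        (asAlgebraHom_ofModule'_apply a _) }
  exact (irreducible_iff_isSimpleModule_asModule _).mpr (IsSimpleModule.congr e)

theorem MonoidAlgebra.smul_eq_zero_of_sum_mul_irrChar_eq_zero [Fintype G]
    [IsSimpleModule (MonoidAlgebra ℂ G) M] {f : G → ℂ} (hf : ∀ g h, f (h * g * h⁻¹) = f g)
    (h : ∀ V : FDRep ℂ G, CategoryTheory.Simple V → ∑ g, f g * V.character g = 0) (x : M) :
    (∑ g, MonoidAlgebra.single g (f g)) • x = 0 := by
  let σ : Representation ℂ G M := Representation.ofModule' M
  have : σ.IsIrreducible := Representation.isIrreducible_ofModule'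
  have : FiniteDimensional ℂ M := Module.Finite.trans (MonoidAlgebra ℂ G) M
  have h0 := σ.sum_smul_eq_zero_of_sum_mul_char_eq_zero hf
    (h (FDRep.of σ) (FDRep.simple_of_isIrreducible σ))
  rw [← Representation.asAlgebraHom_ofModule'_apply, map_sum]
  simpa using LinearMap.congr_fun h0 x

end OfModule

theorem eq_zero_of_forall_sum_mul_irrChar_eq_zero {G : Type} [Group G] [Fintype G] {f : G → ℂ}
    (hf : ∀ g h, f (h * g * h⁻¹) = f g)
    (h : ∀ V : FDRep ℂ G, CategoryTheory.Simple V → ∑ g, f g * V.character g = 0) : f = 0 := by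
  have ha : ∑ g, MonoidAlgebra.single g (f g) ∈ Ring.jacobson (MonoidAlgebra ℂ G) := by
    rw [Ring.jacobson_eq_sInf_isMaximal, Submodule.mem_sInf]
    intro m (hm : Ideal.IsMaximal m)
    have : IsSimpleModule (MonoidAlgebra ℂ G) (MonoidAlgebra ℂ G ⧸ m) :=
      isSimpleModule_iff_isCoatom.mpr hm.1
    have h1 := MonoidAlgebra.smul_eq_zero_of_sum_mul_irrChar_eq_zero hf h (m.mkQ 1)
    rwa [← map_smul, smul_eq_mul, mul_one, Submodule.mkQ_apply,
      Submodule.Quotient.mk_eq_zero] at h1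
  rw [IsSemisimpleRing.jacobson_eq_bot, Submodule.mem_bot] at ha
  classical
  ext g
  simpa [MonoidAlgebra.coeff_sum, Finsupp.finsetSum_apply, Finsupp.single_apply] using
    congrArg (fun x : MonoidAlgebra ℂ G ↦ x.coeff g) ha

theorem FDRep.char_eq_of_isConj {G : Type} [Group G] (V : FDRep ℂ G) {g h : G}
    (hgh : IsConj g h) : V.character g = V.character h := by
  obtain ⟨c, rfl⟩ := isConj_iff.mp hgh
  exact (V.char_conj g c).symm

/-- The character of `V`, viewed as a function on conjugacy classes. -/
noncomputable def FDRep.classCharacter {G : Type} [Group G] (V : FDRep ℂ G) :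
    ConjClasses G → ℂ :=
  Quotient.lift V.character fun _ _ ↦ V.char_eq_of_isConj

theorem FDRep.classCharacter_mk {G : Type} [Group G] (V : FDRep ℂ G) (g : G) :
    V.classCharacter (ConjClasses.mk g) = V.character g :=
  rfl

theorem FDRep.character_inv {G : Type} [Group G] [Finite G] (V : FDRep ℂ G) (g : G) :
    V.character g⁻¹ = (starRingEnd ℂ) (V.character g) :=
  Representation.char_inv_eq_conj V.ρ g

theorem FDRep.classCharacter_eq_finrank_iff {G : Type} [Group G] [Finite G] (V : FDRep ℂ G)
    (C : ConjClasses G) :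
    V.classCharacter C = finrank ℂ V ↔ ∀ g ∈ C.carrier, V.ρ g = 1 := by
  refine ⟨fun h g hg ↦ (Representation.char_eq_finrank_iff V.ρ g).mp ?_, fun h ↦ ?_⟩
  · rwa [← ConjClasses.mem_carrier_iff_mk_eq.mp hg] at h
  · obtain ⟨g, rfl⟩ := ConjClasses.mk_surjective C
    exact (Representation.char_eq_finrank_iff V.ρ g).mpr (h g ConjClasses.mem_carrier_mk)

section IrreducibleCharacters

variable {G : Type} [Group G] {Irr : Finset (G → ℂ)}

theorem exists_eq_sum_conj_irrChar (hIrr : ∀ χ, χ ∈ Irr ↔ IsIrrChar G χ) (v : Irr → ℂ) :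
    ∃ φ : ConjClasses G → ℂ, ∀ g, φ (ConjClasses.mk g) =
      ∑ j : Irr, v j * (starRingEnd ℂ) ((j : G → ℂ) g) := by
  choose V _ hV using fun j : Irr ↦ (hIrr j).mp j.2
  exact ⟨fun C ↦ ∑ j : Irr, v j * (starRingEnd ℂ) ((V j).classCharacter C), fun g ↦ by
    simp only [FDRep.classCharacter_mk, hV]⟩

variable [Fintype G]

theorem innChar_irr_self (hIrr : ∀ χ, χ ∈ Irr ↔ IsIrrChar G χ) (i : Irr) :
    innChar G i i = 1 := by
  obtain ⟨V, _, hV⟩ := (hIrr i).mp i.2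
  have : Invertible (Nat.card G : ℂ) := invertibleOfNonzero (by simp)
  have h := FDRep.char_orthonormal V V
  rw [if_pos ⟨CategoryTheory.Iso.refl V⟩] at h
  simpa only [innChar, FDRep.character_inv, hV, Nat.card_eq_fintype_card] using h

theorem innChar_irr_of_ne (hIrr : ∀ χ, χ ∈ Irr ↔ IsIrrChar G χ) {i j : Irr} (hij : i ≠ j) :
    innChar G i j = 0 := by
  obtain ⟨V, _, hV⟩ := (hIrr i).mp i.2
  obtain ⟨W, _, hW⟩ := (hIrr j).mp j.2
  have : Invertible (Nat.card G : ℂ) := invertibleOfNonzero (by simp)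
  have h := FDRep.char_orthonormal V W
  rw [if_neg fun ⟨e⟩ ↦ hij (Subtype.ext (by rw [← hV, ← hW, FDRep.char_iso e]))] at h
  simpa only [innChar, FDRep.character_inv, hV, hW, Nat.card_eq_fintype_card] using h

variable (Irr) in
/-- The bilinear pairing of a function on conjugacy classes with each member of `Irr`. -/
noncomputable def charPairing : (ConjClasses G → ℂ) →ₗ[ℂ] (Irr → ℂ) where
  toFun φ i := (Fintype.card G : ℂ)⁻¹ * ∑ g, φ (ConjClasses.mk g) * (i : G → ℂ) g
  map_add' φ ψ := by
    ext i
    simp [add_mul, Finset.sum_add_distrib, mul_add]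
  map_smul' c φ := by
    ext i
    simp only [Pi.smul_apply, smul_eq_mul, RingHom.id_apply, mul_assoc, ← Finset.mul_sum]
    ring

theorem charPairing_injective (hIrr : ∀ χ, χ ∈ Irr ↔ IsIrrChar G χ) :
    Function.Injective (charPairing Irr) := by
  rw [injective_iff_map_eq_zero]
  intro φ hφ
  have h : (fun g ↦ φ (ConjClasses.mk g)) = 0 := by
    refine eq_zero_of_forall_sum_mul_irrChar_eq_zero (fun g h ↦ ?_) fun V hV ↦ ?_
    · exact congrArg φ (ConjClasses.mk_eq_mk_iff_isConj.mpr (isConj_iff.mpr ⟨h, rfl⟩)).symm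
    · have := congrFun hφ ⟨V.character, (hIrr _).mpr ⟨V, hV, rfl⟩⟩
      exact (mul_eq_zero.mp this).resolve_left (by simp)
  ext C
  obtain ⟨g, rfl⟩ := ConjClasses.mk_surjective C
  exact congrFun h g

theorem charPairing_mul_of_eq_sum {φ : ConjClasses G → ℂ} {v : Irr → ℂ}
    (hφ : ∀ g, φ (ConjClasses.mk g) = ∑ j : Irr, v j * (starRingEnd ℂ) ((j : G → ℂ) g))
    (ψ : ConjClasses G → ℂ) (i : Irr) :
    charPairing Irr (ψ * φ) i =
      ∑ j : Irr, innChar G ((ψ ∘ ConjClasses.mk) * (i : G → ℂ)) j * v j := by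
  simp only [charPairing, LinearMap.coe_mk, AddHom.coe_mk, innChar, Pi.mul_apply, hφ,
    Function.comp_apply, mul_assoc, Finset.mul_sum, Finset.sum_mul]
  rw [Finset.sum_comm]
  exact Finset.sum_congr rfl fun j _ ↦ Finset.sum_congr rfl fun g _ ↦ by ring

theorem charPairing_of_eq_sum (hIrr : ∀ χ, χ ∈ Irr ↔ IsIrrChar G χ) {φ : ConjClasses G → ℂ}
    {v : Irr → ℂ}
    (hφ : ∀ g, φ (ConjClasses.mk g) = ∑ j : Irr, v j * (starRingEnd ℂ) ((j : G → ℂ) g)) :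
    charPairing Irr φ = v := by
  ext i
  rw [← one_mul φ, charPairing_mul_of_eq_sum hφ, Finset.sum_eq_single i]
  · rw [Pi.one_comp, one_mul, innChar_irr_self hIrr, one_mul]
  · intro j _ hj
    rw [Pi.one_comp, one_mul, innChar_irr_of_ne hIrr hj.symm, zero_mul]
  · simp

theorem charPairing_bijective (hIrr : ∀ χ, χ ∈ Irr ↔ IsIrrChar G χ) :
    Function.Bijective (charPairing Irr) := by
  refine ⟨charPairing_injective hIrr, fun v ↦ ?_⟩
  obtain ⟨φ, hφ⟩ := exists_eq_sum_conj_irrChar hIrr v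
  exact ⟨φ, charPairing_of_eq_sum hIrr hφ⟩

theorem mcKay_apply_charPairing [DecidableEq (G → ℂ)]
    (hIrr : ∀ χ, χ ∈ Irr ↔ IsIrrChar G χ) (ρ : FDRep ℂ G) (φ : ConjClasses G → ℂ) :
    Matrix.toLin' (Matrix.of fun i j : ↑Irr => innChar G (ρ.character * ↑i) ↑j)
      (charPairing Irr φ) = charPairing Irr (ρ.classCharacter * φ) := by
  obtain ⟨φ', hφ'⟩ := exists_eq_sum_conj_irrChar hIrr (charPairing Irr φ)
  obtain rfl : φ' = φ := charPairing_injective hIrr (charPairing_of_eq_sum hIrr hφ')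
  ext i
  rw [charPairing_mul_of_eq_sum hφ']
  rfl

end IrreducibleCharacters

/-- The dimension of the `dim ρ`-eigenspace of the McKay matrix `A_ρ(G)` equals the number
of conjugacy classes of `G` contained in `ker ρ`. -/
theorem mckay_eigenspace_dim_eq_card_ker_classes (G : Type) [Group G] [Fintype G]
    [DecidableEq (G → ℂ)]
    (Irr : Finset (G → ℂ)) (hIrr : ∀ χ, χ ∈ Irr ↔ IsIrrChar G χ)
    (ρ : FDRep ℂ G) :
    Module.finrank ℂ
      (Module.End.eigenspace
        (Matrix.toLin' (Matrix.of fun i j : ↑Irr => innChar G (ρ.character * ↑i) ↑j))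
        (Module.finrank ℂ ρ : ℂ))
      = Nat.card {C : ConjClasses G // ∀ g ∈ C.carrier, ρ.ρ g = 1} := by
  have : DecidableEq (ConjClasses G) := Classical.decEq _
  let S : Set (ConjClasses G) := {C | ∀ g ∈ C.carrier, ρ.ρ g = 1}
  have : Fintype S := Fintype.ofFinite S
  have : DecidablePred (· ∈ S) := Classical.decPred _
  let e : (ConjClasses G → ℂ) ≃ₗ[ℂ] (Irr → ℂ) :=
    LinearEquiv.ofBijective (charPairing Irr) (charPairing_bijective hIrr)
  have hmem : (⨅ C ∈ Sᶜ, LinearMap.ker (LinearMap.proj C : (ConjClasses G → ℂ) →ₗ[ℂ] ℂ)) =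
      (Module.End.eigenspace
        (Matrix.toLin' (Matrix.of fun i j : ↑Irr => innChar G (ρ.character * ↑i) ↑j))
        (Module.finrank ℂ ρ : ℂ)).comap e.toLinearMap := by
    ext φ
    have he (ψ) : e ψ = charPairing Irr ψ := rfl
    rw [Submodule.mem_comap, LinearEquiv.coe_coe, Module.End.mem_eigenspace_iff, he,
      mcKay_apply_charPairing hIrr, ← map_smul, (charPairing_injective hIrr).eq_iff, funext_iff]
    simp only [Submodule.mem_iInf, LinearMap.mem_ker, LinearMap.proj_apply, Pi.mul_apply,
      Pi.smul_apply, smul_eq_mul, mul_eq_mul_right_iff, FDRep.classCharacter_eq_finrank_iff]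
    exact forall_congr' fun C ↦ or_iff_not_imp_left.symm
  rw [← (LinearEquiv.ofSubmodule' e _).finrank_eq, ← hmem,
    (LinearMap.iInfKerProjEquiv ℂ (fun _ : ConjClasses G ↦ ℂ) (I := S) (J := Sᶜ)
      disjoint_compl_right (by simp)).finrank_eq, Module.finrank_fintype_fun_eq_card,
    ← Nat.card_eq_fintype_card]
  rfl
end

section
/- Let G be a finite group and ρ a finite-dimensional complex representation of G with character χ_ρ. The number of connected components of the McKay quiver of ρ — that is, the number of equivalence classes of Irr(G) under the equivalence relation generated by the relation 'χ → χ₁ iff ⟨χ_ρ · χ, χ₁⟩ ≥ 1' — equals the number of conjugacy classes of G contained in ker ρ. -/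
open scoped ComplexOrder

theorem exists_unitary_matrix_rep {G V : Type*} [Group G] [Fintype G] [AddCommGroup V]
    [Module ℂ V] [FiniteDimensional ℂ V] (ρ : Representation ℂ G V) :
    ∃ U : G →* Matrix.unitaryGroup (Fin (Module.finrank ℂ V)) ℂ,
      (∀ g, (U g).1.trace = LinearMap.trace ℂ V (ρ g)) ∧
      ∀ g, U g = 1 → ρ g = 1 := by
  classical
  let b := Module.finBasis ℂ V
  let R : G →* Matrix (Fin (Module.finrank ℂ V)) (Fin (Module.finrank ℂ V)) ℂ :=
    (LinearMap.toMatrixAlgEquiv b : _ →* _).comp ρ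
  let P := ∑ g, (R g).conjTranspose * R g
  have hP : P.PosDef := by
    have h1 : P = (R 1).conjTranspose * R 1 +
        ∑ g ∈ Finset.univ.erase 1, (R g).conjTranspose * R g :=
      (Finset.add_sum_erase _ _ (Finset.mem_univ 1)).symm
    rw [h1]
    refine Matrix.PosDef.add_posSemidef (by simpa using Matrix.PosDef.one) ?_
    exact Matrix.posSemidef_sum _ fun g _ => Matrix.posSemidef_conjTranspose_mul_self _
  have hinv (g : G) : (R g).conjTranspose * P * R g = P := by
    simp only [P, Finset.mul_sum, Finset.sum_mul]
    refine Fintype.sum_equiv (Equiv.mulRight g) _ _ fun x => ?_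
    simp [Matrix.conjTranspose_mul, mul_assoc]
  obtain ⟨C, hC⟩ : ∃ C, P = C.conjTranspose * C := by
    open scoped MatrixOrder in
    exact CStarAlgebra.nonneg_iff_eq_star_mul_self.mp hP.posSemidef.nonneg
  have hCu : IsUnit C := by
    have := hP.isUnit
    rw [hC] at this
    rw [Matrix.isUnit_iff_isUnit_det] at this ⊢
    rw [Matrix.det_mul] at this
    exact isUnit_of_mul_isUnit_right this
  obtain ⟨C, rfl⟩ := hCu
  have hU (g : G) : C.1 * R g * C⁻¹.1 ∈ Matrix.unitaryGroup _ ℂ := by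
    rw [Matrix.mem_unitaryGroup_iff']
    have h := hinv g
    rw [hC] at h
    have h2 : star C⁻¹.1 * star C.1 = 1 := by
      rw [← star_mul]; simp
    calc _ = star C⁻¹.1 * ((R g).conjTranspose * (C.1.conjTranspose * C.1) * R g) * ↑C⁻¹ := by
          simp only [star_mul, mul_assoc]; rfl
      _ = (star C⁻¹.1 * star C.1) * (C.1 * ↑C⁻¹) := by
          rw [h]; simp only [mul_assoc]; rfl
      _ = 1 := by rw [h2]; simp
  refine ⟨⟨⟨fun g => ⟨_, hU g⟩, by ext1; simp⟩, fun x y => by ext1; simp [mul_assoc]⟩,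
    fun g => ?_, fun g hg => ?_⟩
  · change Matrix.trace (C.1 * R g * C⁻¹.1) = _
    rw [Matrix.trace_units_conj]
    exact (LinearMap.trace_eq_matrix_trace ℂ b (ρ g)).symm
  · have h : C.1 * R g * C⁻¹.1 = 1 := congrArg Subtype.val hg
    rw [Units.mul_inv_eq_iff_eq_mul, one_mul] at h
    have h3 : R g = 1 := C.isUnit.mul_eq_left.mp h
    exact (LinearMap.toMatrixAlgEquiv b).injective (h3.trans (map_one _).symm)

namespace Representation
variable {G V : Type*} [Group G] [Fintype G] [AddCommGroup V] [Module ℂ V]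
    [FiniteDimensional ℂ V] (ρ : Representation ℂ G V)

theorem character_inv_eq_conj (g : G) : ρ.character g⁻¹ = (starRingEnd ℂ) (ρ.character g) := by
  obtain ⟨U, hU, -⟩ := exists_unitary_matrix_rep ρ
  rw [character, character, ← hU, ← hU, map_inv, Matrix.UnitaryGroup.inv_val,
    Matrix.star_eq_conjTranspose, Matrix.trace_conjTranspose]
  rfl

theorem eq_one_of_character_eq_finrank {g : G} (h : ρ.character g = Module.finrank ℂ V) :
    ρ g = 1 := by
  obtain ⟨U, hU, hU'⟩ := exists_unitary_matrix_rep ρ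
  refine hU' g (Subtype.ext ?_)
  have htr : (U g).1.trace = Module.finrank ℂ V := (hU g).trans h
  have huu : (U g).1.conjTranspose * U g = 1 := (Matrix.mem_unitaryGroup_iff').mp (U g).2
  have key : (((U g).1 - 1).conjTranspose * ((U g).1 - 1)).trace = 0 := by
    simp [sub_mul, mul_sub, huu, Matrix.trace_sub, Matrix.trace_conjTranspose, htr]
  exact sub_eq_zero.mp (Matrix.trace_conjTranspose_mul_self_eq_zero_iff.mp key)
end Representation

open scoped MonoidAlgebra in
theorem MonoidAlgebra.smul_eq_zero_of_asAlgebraHom_eq_zero {G : Type} [Group G] [Fintype G]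
    {a : ℂ[G]}
    (h : ∀ (V : Type) [AddCommGroup V] [Module ℂ V] [FiniteDimensional ℂ V]
      (ρ : Representation ℂ G V), ρ.IsIrreducible → ρ.asAlgebraHom a = 0)
    (M : Type) [AddCommGroup M] [Module ℂ[G] M] [IsSimpleModule ℂ[G] M] (x : M) : a • x = 0 := by
  let _ : Module ℂ M := Module.compHom M (algebraMap ℂ ℂ[G])
  have _ : IsScalarTower ℂ ℂ[G] M := IsScalarTower.of_algebraMap_smul fun _ _ => rfl
  have hfd : FiniteDimensional ℂ M := Module.Finite.trans ℂ[G] M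
  let σ : Representation ℂ G M := Representation.ofModule' M
  have hσ : σ.asAlgebraHom = Algebra.lsmul ℂ ℂ M :=
    (MonoidAlgebra.lift ℂ (M →ₗ[ℂ] M) G).apply_symm_apply _
  let e : σ.asModule ≃ₗ[ℂ[G]] M :=
    { σ.asModuleEquiv with
      map_smul' := fun r y => by
        change σ.asModuleEquiv (r • y) = r • σ.asModuleEquiv y
        rw [Representation.asModuleEquiv_map_smul, hσ, Algebra.lsmul_coe] }
  have hirr : σ.IsIrreducible :=
    (Representation.irreducible_iff_isSimpleModule_asModule σ).mpr (IsSimpleModule.congr e)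
  have h1 := LinearMap.congr_fun (h M σ hirr) x
  rwa [hσ] at h1

open scoped MonoidAlgebra in
theorem MonoidAlgebra.eq_zero_of_asAlgebraHom_eq_zero {G : Type} [Group G] [Fintype G]
    {a : ℂ[G]}
    (h : ∀ (V : Type) [AddCommGroup V] [Module ℂ V] [FiniteDimensional ℂ V]
      (ρ : Representation ℂ G V), ρ.IsIrreducible → ρ.asAlgebraHom a = 0) : a = 0 := by
  have : NeZero (Nat.card G : ℂ) := ⟨by simp⟩
  have hj : Ring.jacobson ℂ[G] = ⊥ := IsSemisimpleModule.jacobson_eq_bot _ _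
  rw [← Submodule.mem_bot ℂ[G], ← hj, Ring.jacobson_eq_sInf_isMaximal, Submodule.mem_sInf]
  intro m hm
  have hs : IsSimpleModule ℂ[G] (ℂ[G] ⧸ m) :=
    isSimpleModule_iff_isCoatom.mpr (show Ideal.IsMaximal m from hm).out
  have h2 := smul_eq_zero_of_asAlgebraHom_eq_zero h _ (Submodule.Quotient.mk (p := m) 1)
  rw [← Submodule.Quotient.mk_smul] at h2
  simpa using (Submodule.Quotient.mk_eq_zero m).mp h2

theorem Representation.sum_smul_eq_zero_of_sum_character_eq_zero {G V : Type*} [Group G] [Fintype G]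
    [AddCommGroup V] [Module ℂ V] [FiniteDimensional ℂ V] (ρ : Representation ℂ G V)
    [ρ.IsIrreducible] (c : G → ℂ) (hc : ∀ g h, c (h * g * h⁻¹) = c g)
    (h0 : ∑ g, c g * ρ.character g = 0) : ∑ g, c g • ρ g = 0 := by
  obtain ⟨z, hz⟩ := (IsIrreducible.algebraMap_intertwiningMap_bijective_of_isAlgClosed (ρ := ρ)).2
    ⟨∑ g, c g • ρ g, fun h => by
      change (∑ g, c g • ρ g) * ρ h = ρ h * (∑ g, c g • ρ g)
      rw [Finset.sum_mul, Finset.mul_sum]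
      refine Fintype.sum_equiv (MulAut.conj h⁻¹).toEquiv _ _ fun x => ?_
      have := hc x h⁻¹
      simp only [inv_inv, mul_assoc] at this
      simp [← map_mul, mul_assoc, this]⟩
  have hz' : z • (1 : V →ₗ[ℂ] V) = ∑ g, c g • ρ g := congrArg IntertwiningMap.toLinearMap hz
  have ht := congrArg (LinearMap.trace ℂ V) hz'
  simp only [map_smul, map_sum, LinearMap.trace_one, smul_eq_mul] at ht
  have hne : (Module.finrank ℂ V : ℂ) ≠ 0 := by
    have : Nontrivial V := IsSimpleModule.nontrivial (MonoidAlgebra ℂ G) ρ.asModule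
    exact_mod_cast Module.finrank_pos.ne'
  have : z = 0 := by
    refine (mul_eq_zero.mp (ht.trans ?_)).resolve_right hne
    exact h0
  rw [← hz', this, zero_smul]

theorem innChar_sub {G : Type} [Group G] [Fintype G] (φ ψ χ : G → ℂ) :
    innChar G (φ - ψ) χ = innChar G φ χ - innChar G ψ χ := by
  simp [innChar, sub_mul, Finset.sum_sub_distrib, mul_sub]

theorem innChar_smul {G : Type} [Group G] [Fintype G] (c : ℂ) (φ ψ : G → ℂ) :
    innChar G (c • φ) ψ = c * innChar G φ ψ := by
  simp only [innChar, Pi.smul_apply, smul_eq_mul, mul_assoc, ← Finset.mul_sum]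
  ring

theorem innChar_sum_smul {G ι : Type} [Group G] [Fintype G] (s : Finset ι) (c : ι → ℂ)
    (φ : ι → G → ℂ) (ψ : G → ℂ) :
    innChar G (∑ i ∈ s, c i • φ i) ψ = ∑ i ∈ s, c i * innChar G (φ i) ψ := by
  simp only [innChar, Finset.sum_apply, Pi.smul_apply, smul_eq_mul, Finset.sum_mul, Finset.mul_sum]
  rw [Finset.sum_comm]
  refine Finset.sum_congr rfl fun i _ => Finset.sum_congr rfl fun g _ => by ring

theorem FDRep.character_inv_eq_conj {G : Type} [Group G] [Fintype G] (V : FDRep ℂ G) (g : G) :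
    V.character g⁻¹ = (starRingEnd ℂ) (V.character g) :=
  Representation.character_inv_eq_conj V.ρ g

theorem isIrrChar_character {G V : Type} [Group G] [Fintype G] [AddCommGroup V] [Module ℂ V]
    [FiniteDimensional ℂ V] (ρ : Representation ℂ G V) [ρ.IsIrreducible] :
    IsIrrChar G ρ.character := by
  refine ⟨FDRep.of ρ, ?_, rfl⟩
  have hne : (Nat.card G : ℂ) ≠ 0 := by simp
  have := invertibleOfNonzero hne
  rw [FDRep.simple_iff_char_is_norm_one]
  have h := Representation.char_orthonormal ρ ρ
  rw [if_pos ⟨Representation.Equiv.refl ρ⟩, inv_mul_eq_one₀ hne] at h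
  exact h.symm

theorem IsIrrChar.innChar_eq {G : Type} [Group G] [Fintype G] {χ ψ : G → ℂ} (hχ : IsIrrChar G χ)
    (hψ : IsIrrChar G ψ) [Decidable (χ = ψ)] : innChar G χ ψ = if χ = ψ then 1 else 0 := by
  classical
  obtain ⟨V, hV, rfl⟩ := hχ
  obtain ⟨W, hW, rfl⟩ := hψ
  have hne : (Nat.card G : ℂ) ≠ 0 := by simp
  have := invertibleOfNonzero hne
  have h (V W : FDRep ℂ G) [CategoryTheory.Simple V] [CategoryTheory.Simple W] :
      innChar G V.character W.character = if Nonempty (V ≅ W) then 1 else 0 := by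
    rw [← FDRep.char_orthonormal, innChar, Nat.card_eq_fintype_card]
    simp only [FDRep.character_inv_eq_conj]
  split_ifs with heq
  · rw [← heq, h, if_pos ⟨CategoryTheory.Iso.refl V⟩]
  · rw [h, if_neg]
    rintro ⟨i⟩
    exact heq (FDRep.char_iso i)

open scoped CategoryTheory.MonoidalCategory in
theorem IsIrrChar.exists_nat_innChar_mul_eq {G : Type} [Group G] [Fintype G] (ρ : FDRep ℂ G)
    {χ ψ : G → ℂ} (hχ : IsIrrChar G χ) (hψ : IsIrrChar G ψ) :
    ∃ m : ℕ, innChar G (ρ.character * χ) ψ = m := by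
  obtain ⟨V, -, rfl⟩ := hχ
  obtain ⟨W, -, rfl⟩ := hψ
  have := invertibleOfNonzero (show (Nat.card G : ℂ) ≠ 0 by simp)
  refine ⟨_, .trans ?_ (FDRep.scalar_product_char_eq_finrank_equivariant W (ρ ⊗ V))⟩
  simp only [innChar, FDRep.character_inv_eq_conj, FDRep.char_tensor, Nat.card_eq_fintype_card]

theorem IsIrrChar.exists_nat_apply_one_eq {G : Type} [Group G] [Fintype G] {χ : G → ℂ}
    (hχ : IsIrrChar G χ) : ∃ d : ℕ, 0 < d ∧ χ 1 = d := by
  obtain ⟨V, hV, rfl⟩ := hχ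
  refine ⟨_, Nat.pos_of_ne_zero fun h0 => ?_, FDRep.char_one V⟩
  have : Subsingleton V := Module.finrank_zero_iff.mp h0
  have h := (FDRep.simple_iff_char_is_norm_one V).mp hV
  have hz (g : G) : V.character g = 0 := by
    rw [FDRep.character, Subsingleton.elim (V.ρ g) 0, map_zero]
  exact (Nat.cast_ne_zero.mpr Nat.card_pos.ne') (h.symm.trans (by simp [hz]))

theorem IsIrrChar.map_conj {G : Type} [Group G] [Fintype G] {χ : G → ℂ}
    (hχ : IsIrrChar G χ) (g h : G) : χ (h * g * h⁻¹) = χ g := by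
  obtain ⟨V, -, rfl⟩ := hχ
  exact V.char_conj g h

theorem eq_zero_of_innChar_eq_zero {G : Type} [Group G] [Fintype G] {f : G → ℂ}
    (hf : ∀ g h, f (h * g * h⁻¹) = f g) (h0 : ∀ χ, IsIrrChar G χ → innChar G f χ = 0) : f = 0 := by
  have ha : (∑ g : G, MonoidAlgebra.single g (f g⁻¹)) = 0 := by
    refine MonoidAlgebra.eq_zero_of_asAlgebraHom_eq_zero fun V _ _ _ ρ hρ => ?_
    simp only [map_sum, Representation.asAlgebraHom_single]
    refine ρ.sum_smul_eq_zero_of_sum_character_eq_zero _ (fun g h => ?_) ?_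
    · rw [← hf g⁻¹ h]
      simp [mul_assoc]
    · have h1 := h0 _ (isIrrChar_character ρ)
      rw [innChar, mul_eq_zero] at h1
      rw [← h1.resolve_left (by simp)]
      refine Fintype.sum_equiv (Equiv.inv G) _ _ fun g => ?_
      simp [← ρ.character_inv_eq_conj]
  funext g
  classical
  have := congrArg (fun a : MonoidAlgebra ℂ G => a.coeff g⁻¹) ha
  simpa [Finsupp.single_apply] using this

theorem eq_of_innChar_eq {G : Type} [Group G] [Fintype G] {f f' : G → ℂ}
    (hf : ∀ g h, f (h * g * h⁻¹) = f g) (hf' : ∀ g h, f' (h * g * h⁻¹) = f' g)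
    (h : ∀ χ, IsIrrChar G χ → innChar G f χ = innChar G f' χ) : f = f' :=
  sub_eq_zero.mp <| eq_zero_of_innChar_eq_zero (fun g x => by simp [hf, hf'])
    fun χ hχ => by rw [innChar_sub, h χ hχ, sub_self]

section CharacterBasis

variable {G : Type} [Group G] [Fintype G] {Irr : Finset (G → ℂ)}
  (hIrr : ∀ χ, χ ∈ Irr ↔ IsIrrChar G χ)

include hIrr

theorem innChar_sum_smul_irr (c : Irr → ℂ) (ψ : Irr) :
    innChar G (∑ χ, c χ • χ.1) ψ = c ψ := by
  classical
  rw [innChar_sum_smul, Finset.sum_eq_single_of_mem ψ (Finset.mem_univ _)]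
  · rw [((hIrr ψ).mp ψ.2).innChar_eq ((hIrr ψ).mp ψ.2), if_pos rfl, mul_one]
  · intro χ _ hne
    rw [((hIrr χ).mp χ.2).innChar_eq ((hIrr ψ).mp ψ.2), if_neg fun h => hne (Subtype.ext h),
      mul_zero]

theorem sum_smul_irr_conj (c : Irr → ℂ) (g h : G) :
    (∑ χ, c χ • χ.1) (h * g * h⁻¹) = (∑ χ, c χ • χ.1) g := by
  simp [fun χ : Irr => ((hIrr χ).mp χ.2).map_conj g h]

theorem eq_sum_innChar_smul {f : G → ℂ} (hf : ∀ g h, f (h * g * h⁻¹) = f g) :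
    f = ∑ χ : Irr, innChar G f χ • χ.1 :=
  eq_of_innChar_eq hf (sum_smul_irr_conj hIrr _) fun ψ hψ =>
    (innChar_sum_smul_irr hIrr (fun χ => innChar G f χ.1) ⟨ψ, (hIrr ψ).mpr hψ⟩).symm

omit hIrr in
theorem innChar_mul_sum_smul_irr (φ : G → ℂ) (c : Irr → ℂ) (ψ : G → ℂ) :
    innChar G (φ * ∑ χ, c χ • χ.1) ψ = ∑ χ, c χ * innChar G (φ * χ.1) ψ := by
  rw [Finset.mul_sum, ← innChar_sum_smul]
  simp only [mul_smul_comm]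

theorem sum_innChar_mul_apply_one {φ : G → ℂ} (hφ : ∀ g h, φ (h * g * h⁻¹) = φ g) (χ : Irr) :
    ∑ ψ : Irr, innChar G (φ * χ.1) ψ * ψ.1 1 = φ 1 * χ.1 1 := by
  have h := congrFun (eq_sum_innChar_smul hIrr (f := φ * χ.1) fun g h => by
    simp [hφ, ((hIrr χ).mp χ.2).map_conj]) 1
  simpa using h.symm

theorem sum_apply_one_mul_innChar (φ : G → ℂ) (ψ : Irr) :
    ∑ χ : Irr, χ.1 1 * innChar G (φ * χ.1) ψ = φ 1 * ψ.1 1 := by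
  classical
  have hreal (χ : Irr) : (starRingEnd ℂ) (χ.1 1) = χ.1 1 := by
    obtain ⟨d, -, hd⟩ := ((hIrr χ).mp χ.2).exists_nat_apply_one_eq
    rw [hd, map_natCast]
  have hin (z : ℂ) (χ : Irr) :
      innChar G (Pi.single 1 (Fintype.card G * z)) χ = z * χ.1 1 := by
    rw [innChar, Finset.sum_eq_single_of_mem 1 (Finset.mem_univ _)
      fun g _ hg => by rw [Pi.single_eq_of_ne hg, zero_mul], Pi.single_eq_same, hreal]
    field_simp
  have hreg : Pi.single 1 (Fintype.card G * 1 : ℂ) = ∑ χ : Irr, χ.1 1 • χ.1 := by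
    rw [eq_sum_innChar_smul hIrr (f := Pi.single 1 (Fintype.card G * 1 : ℂ)) fun g h => by
      simp [Pi.single_apply]]
    simp only [hin, one_mul]
  rw [← innChar_mul_sum_smul_irr, ← hreg, ← hin]
  congr 1
  funext g
  by_cases hg : g = 1
  · subst hg
    simp [mul_comm]
  · simp [hg]

end CharacterBasis

theorem eq_of_sum_mul_eq_mul {ι : Type*} [Fintype ι] {A : ι → ι → ℕ} {d : ι → ℕ} {n : ℂ}
    (hrow : ∀ i, ∑ j, (A i j : ℂ) * d j = n * d i) (hcol : ∀ j, ∑ i, (d i : ℂ) * A i j = n * d j)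
    {h : ι → ℂ} (hh : ∀ j, ∑ i, (d i : ℂ) * h i * A i j = n * (d j * h j))
    (hd : ∀ i, 0 < d i) {i j : ι} (hA : 0 < A i j) : h i = h j := by
  let c := starRingEnd ℂ
  have hn : c n = n := by
    have h1 := congrArg c (hrow i)
    simp only [c, map_sum, map_mul, map_natCast] at h1
    rw [hrow i] at h1
    exact (mul_right_cancel₀ (by exact_mod_cast (hd i).ne') h1).symm
  have hh' (j) : ∑ i, (d i : ℂ) * c (h i) * A i j = n * (d j * c (h j)) := by
    simpa [c, map_sum, map_mul, map_natCast, hn] using congrArg c (hh j)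
  let w (i j : ι) : ℂ := d i * A i j * d j
  have e1 : ∑ i, ∑ j, w i j * (h i * c (h i)) = ∑ i, n * (d i * d i * (h i * c (h i))) := by
    refine Finset.sum_congr rfl fun i _ => ?_
    rw [show n * (d i * d i * (h i * c (h i))) = n * d i * (d i * (h i * c (h i))) by ring,
      ← hrow i, Finset.sum_mul]
    exact Finset.sum_congr rfl fun j _ => by simp only [w]; ring
  have e2 : ∑ i, ∑ j, w i j * (h j * c (h j)) = ∑ i, n * (d i * d i * (h i * c (h i))) := by
    rw [Finset.sum_comm]
    refine Finset.sum_congr rfl fun i _ => ?_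
    rw [show n * (d i * d i * (h i * c (h i))) = n * d i * (d i * (h i * c (h i))) by ring,
      ← hcol i, Finset.sum_mul]
    exact Finset.sum_congr rfl fun j _ => by simp only [w]; ring
  have e3 : ∑ i, ∑ j, w i j * (h i * c (h j)) = ∑ i, n * (d i * d i * (h i * c (h i))) := by
    rw [Finset.sum_comm]
    refine Finset.sum_congr rfl fun i _ => ?_
    rw [show n * (d i * d i * (h i * c (h i))) = n * (d i * h i) * (d i * c (h i)) by ring,
      ← hh i, Finset.sum_mul]
    exact Finset.sum_congr rfl fun j _ => by simp only [w]; ring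
  have e4 : ∑ i, ∑ j, w i j * (h j * c (h i)) = ∑ i, n * (d i * d i * (h i * c (h i))) := by
    rw [Finset.sum_comm]
    refine Finset.sum_congr rfl fun i _ => ?_
    rw [show n * (d i * d i * (h i * c (h i))) = n * (d i * c (h i)) * (d i * h i) by ring,
      ← hh' i, Finset.sum_mul]
    exact Finset.sum_congr rfl fun j _ => by simp only [w]; ring
  have key : ∑ i, ∑ j, w i j * ((h i - h j) * c (h i - h j)) = 0 := by
    calc _ = ∑ i, ∑ j, w i j * (h i * c (h i)) + ∑ i, ∑ j, w i j * (h j * c (h j))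
          - ∑ i, ∑ j, w i j * (h i * c (h j)) - ∑ i, ∑ j, w i j * (h j * c (h i)) := by
            simp only [← Finset.sum_add_distrib, ← Finset.sum_sub_distrib]
            refine Finset.sum_congr rfl fun i _ => Finset.sum_congr rfl fun j _ => ?_
            rw [map_sub]
            ring
      _ = 0 := by
        rw [e1, e2, e3, e4]
        ring
  have hnn (i j) : 0 ≤ w i j * ((h i - h j) * c (h i - h j)) :=
    mul_nonneg (by simp only [w]; positivity) (mul_star_self_nonneg _)
  have h1 := (Finset.sum_eq_zero_iff_of_nonneg fun i _ => Finset.sum_nonneg fun j _ => hnn i j).mp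
    key i (Finset.mem_univ i)
  have h2 := (Finset.sum_eq_zero_iff_of_nonneg fun j _ => hnn i j).mp h1 j (Finset.mem_univ j)
  rw [mul_eq_zero, Complex.mul_conj, Complex.ofReal_eq_zero, Complex.normSq_eq_zero,
    sub_eq_zero] at h2
  refine h2.resolve_left ?_
  have := hd i
  have := hd j
  simp only [w]
  exact_mod_cast (by positivity : 0 < d i * A i j * d j).ne'

section McKayQuiver

variable {G : Type} [Group G] [Fintype G] {Irr : Finset (G → ℂ)}
  (hIrr : ∀ χ, χ ∈ Irr ↔ IsIrrChar G χ) (ρ : FDRep ℂ G)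

include hIrr

theorem mckay_eigenfunction_iff (h : Irr → ℂ) :
    ρ.character * (∑ χ : Irr, (χ.1 1 * h χ) • χ.1) =
        ρ.character 1 • ∑ χ : Irr, (χ.1 1 * h χ) • χ.1 ↔
      ∀ a b : Irr, 1 ≤ innChar G (ρ.character * a.1) b → h a = h b := by
  have hstep : ρ.character * (∑ χ : Irr, (χ.1 1 * h χ) • χ.1) =
        ρ.character 1 • (∑ χ : Irr, (χ.1 1 * h χ) • χ.1) ↔
      ∀ ψ : Irr, ∑ χ : Irr, χ.1 1 * h χ * innChar G (ρ.character * χ.1) ψ =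
        ρ.character 1 * (ψ.1 1 * h ψ) := by
    simp only [← innChar_mul_sum_smul_irr]
    refine ⟨fun heq ψ => ?_, fun hall => ?_⟩
    · rw [heq, innChar_smul, innChar_sum_smul_irr hIrr]
    · refine eq_of_innChar_eq (fun g x => ?_) (fun g x => ?_) fun ψ hψ => ?_
      · rw [Pi.mul_apply, Pi.mul_apply, sum_smul_irr_conj hIrr, FDRep.char_conj]
      · rw [Pi.smul_apply, Pi.smul_apply, sum_smul_irr_conj hIrr]
      · rw [hall ⟨ψ, (hIrr ψ).mpr hψ⟩, innChar_smul,
          innChar_sum_smul_irr hIrr _ ⟨ψ, (hIrr ψ).mpr hψ⟩]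
  rw [hstep]
  have hrow := sum_innChar_mul_apply_one hIrr (φ := ρ.character) fun g h => ρ.char_conj g h
  have hcol := sum_apply_one_mul_innChar hIrr ρ.character
  choose A hA using fun a b : Irr =>
    IsIrrChar.exists_nat_innChar_mul_eq ρ ((hIrr a).mp a.2) ((hIrr b).mp b.2)
  choose d hd0 hd using fun a : Irr => ((hIrr a).mp a.2).exists_nat_apply_one_eq
  simp only [hA, hd] at hrow hcol ⊢
  refine ⟨fun hh a b hab => eq_of_sum_mul_eq_mul hrow hcol hh hd0 (by exact_mod_cast hab),
    fun hh b => ?_⟩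
  rw [← mul_assoc, ← hcol b, Finset.sum_mul]
  refine Finset.sum_congr rfl fun a _ => ?_
  rcases Nat.eq_zero_or_pos (A a b) with h0 | hpos
  · simp [h0]
  · rw [hh a b (by exact_mod_cast hpos)]
    ring

end McKayQuiver

theorem FDRep.eq_one_of_character_eq {G : Type} [Group G] [Fintype G] (ρ : FDRep ℂ G) {g : G}
    (h : ρ.character g = ρ.character 1) : ρ.ρ g = 1 :=
  Representation.eq_one_of_character_eq_finrank ρ.ρ (h.trans ρ.char_one)

/-- The number of connected components of the McKay quiver of `ρ` — the number of
equivalence classes of `Irr(G)` under the equivalence relation generated by the edge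
relation `χ → χ₁ iff ⟨χ_ρ · χ, χ₁⟩ ≥ 1` (i.e. the cardinality of the quotient `Quot` of
the edge relation) — equals the number of conjugacy classes of `G` contained in `ker ρ`. -/
theorem mckay_number_of_components (G : Type) [Group G] [Fintype G]
    (Irr : Finset (G → ℂ)) (hIrr : ∀ χ, χ ∈ Irr ↔ IsIrrChar G χ)
    (ρ : FDRep ℂ G) :
    Nat.card (Quot (fun a b : ↑Irr => 1 ≤ innChar G (ρ.character * ↑a) ↑b))
      = Nat.card {C : ConjClasses G // ∀ g ∈ C.carrier, ρ.ρ g = 1} := by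
  classical
  set r := fun a b : Irr => 1 ≤ innChar G (ρ.character * ↑a) ↑b
  have : Finite (Quot r) := Finite.of_surjective _ Quot.mk_surjective
  have := Fintype.ofFinite (Quot r)
  have := Fintype.ofFinite {C : ConjClasses G // ∀ g ∈ C.carrier, ρ.ρ g = 1}
  have hpos (χ : Irr) : χ.1 1 ≠ 0 := by
    obtain ⟨d, hd0, hd⟩ := ((hIrr χ).mp χ.2).exists_nat_apply_one_eq
    rw [hd]
    exact_mod_cast hd0.ne'
  let L : (Quot r → ℂ) →ₗ[ℂ] ({C : ConjClasses G // ∀ g ∈ C.carrier, ρ.ρ g = 1} → ℂ) :=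
    { toFun := fun u C => (∑ χ : Irr, (χ.1 1 * u (Quot.mk r χ)) • χ.1) (Quotient.out C.1)
      map_add' := fun u v => by
        funext C
        simp [mul_add, add_mul, Finset.sum_add_distrib]
      map_smul' := fun c u => by
        funext C
        simp only [Finset.sum_apply, Pi.smul_apply, smul_eq_mul, RingHom.id_apply, Finset.mul_sum]
        exact Finset.sum_congr rfl fun χ _ => by ring }
  have hker {g : G} (hg : ρ.ρ g = 1) : ∀ x ∈ (ConjClasses.mk g).carrier, ρ.ρ x = 1 := by
    intro x hx
    obtain ⟨c, rfl⟩ := isConj_iff.mp (ConjClasses.mk_eq_mk_iff_isConj.mp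
      (ConjClasses.mem_carrier_iff_mk_eq.mp hx)).symm
    rw [map_mul, map_mul, hg, mul_one, ← map_mul, mul_inv_cancel, map_one]
  have hinj : Function.Injective L := by
    refine (injective_iff_map_eq_zero L).mpr fun u hu => ?_
    have heig := (mckay_eigenfunction_iff hIrr ρ fun χ => u (Quot.mk r χ)).mpr
      fun a b hab => congrArg u (Quot.sound hab)
    have hzero : ∑ χ : Irr, (χ.1 1 * u (Quot.mk r χ)) • χ.1 = 0 := by
      funext g
      by_cases hg : ρ.ρ g = 1
      · obtain ⟨c, hc⟩ := isConj_iff.mp (ConjClasses.mk_eq_mk_iff_isConj.mp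
          (Quotient.out_eq (ConjClasses.mk g)))
        rw [← hc, sum_smul_irr_conj hIrr]
        exact congrFun hu ⟨ConjClasses.mk g, hker hg⟩
      · by_contra hne
        exact hg (ρ.eq_one_of_character_eq (mul_right_cancel₀ hne (congrFun heig g)))
    funext q
    obtain ⟨χ, rfl⟩ := Quot.mk_surjective q
    have h := innChar_sum_smul_irr hIrr (fun χ => χ.1 1 * u (Quot.mk r χ)) χ
    rw [hzero] at h
    refine (mul_eq_zero.mp (h.symm.trans ?_)).resolve_left (hpos χ)
    simp [innChar]
  have hsurj : Function.Surjective L := by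
    intro v
    let v' : ConjClasses G → ℂ := fun C =>
      if hC : ∀ g ∈ C.carrier, ρ.ρ g = 1 then v ⟨C, hC⟩ else 0
    let f : G → ℂ := fun g => v' (ConjClasses.mk g)
    have hf (g h : G) : f (h * g * h⁻¹) = f g :=
      congrArg v' (ConjClasses.mk_eq_mk_iff_isConj.mpr (isConj_iff.mpr ⟨h, rfl⟩).symm)
    have hexp : ∑ χ : Irr, (χ.1 1 * (innChar G f χ / χ.1 1)) • χ.1 = f := by
      simp only [mul_div_cancel₀ _ (hpos _)]
      exact (eq_sum_innChar_smul hIrr hf).symm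
    have hconst := (mckay_eigenfunction_iff hIrr ρ fun χ => innChar G f χ / χ.1 1).mp (by
      rw [hexp]
      funext g
      by_cases hg : ρ.ρ g = 1
      · have : ρ.character g = ρ.character 1 := by
          rw [FDRep.character, FDRep.character, hg, map_one ρ.ρ]
        rw [Pi.mul_apply, Pi.smul_apply, this, smul_eq_mul]
      · have : f g = 0 := dif_neg fun h => hg (h g ConjClasses.mem_carrier_mk)
        rw [Pi.mul_apply, Pi.smul_apply, this, mul_zero, smul_zero])
    refine ⟨Quot.lift (fun χ => innChar G f χ / χ.1 1) hconst, funext fun C => ?_⟩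
    refine (congrFun hexp _).trans ?_
    have hC : ConjClasses.mk (Quotient.out C.1) = C.1 := Quotient.out_eq C.1
    simp only [f, v', hC, dif_pos C.2]
  have := (LinearEquiv.ofBijective L ⟨hinj, hsurj⟩).finrank_eq
  simpa only [Module.finrank_fintype_fun_eq_card, Nat.card_eq_fintype_card] using this
end
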